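/- Let p ∈ ℂ[x,y] be a polynomial such that the quotient ℂ-algebra ℂ[x,y]/(p) is isomorphic as a ℂ-algebra to ℂ[t]. Then there exists a ℂ-algebra automorphism α of ℂ[x,y] such that, setting q = α(p), either q has total degree 1, or there exist coprime integers k, l ≥ 2 and a positive integer n such that the leading quasi-homogeneous part of q with respect to the weights (k,l) equals (x^k + y^l)^n. -/

import Mathlib

open MvPolynomial

/-- The weighted degree of `r ∈ ℂ[x,y]` with respect to the weights `deg x = l`,
`deg y = k`: the maximum of `l·i + k·j` over monomials `x^i y^j` of `r`. -/
noncomputable def wdeg (k l : ℕ) (r : MvPolynomial (Fin 2) ℂ) : ℕ :=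
  r.weightedTotalDegree ![l, k]

/-- The leading quasi-homogeneous part of `r ∈ ℂ[x,y]` with respect to the weights
`(k, l)`: the sum of the monomials `a_{ij} x^i y^j` of `r` with `l·i + k·j` maximal. -/
noncomputable def leadingPart (k l : ℕ) (r : MvPolynomial (Fin 2) ℂ) :
    MvPolynomial (Fin 2) ℂ :=
  ∑ s ∈ r.support.filter (fun s => l * s 0 + k * s 1 = wdeg k l r),
    monomial s (coeff s r)

namespace RL

abbrev P2 := MvPolynomial (Fin 2) ℂ

/-- grading map -/
noncomputable def Th (k l : ℕ) : P2 →ₐ[ℂ] Polynomial P2 :=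
  aeval ![Polynomial.C (X 0) * Polynomial.X ^ l, Polynomial.C (X 1) * Polynomial.X ^ k]

lemma Th_monomial (k l : ℕ) (s : Fin 2 →₀ ℕ) (c : ℂ) :
    Th k l (monomial s c) = Polynomial.monomial (l * s 0 + k * s 1) (monomial s c) := by
  rw [Th, aeval_monomial, Finsupp.prod_fintype _ _ (by simp), Fin.prod_univ_two]
  rw [monomial_eq, Finsupp.prod_fintype _ _ (by simp), Fin.prod_univ_two]
  rw [← Polynomial.C_mul_X_pow_eq_monomial]
  have : algebraMap ℂ (Polynomial P2) c = Polynomial.C (C c) := rfl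
  rw [this]
  simp only [Matrix.cons_val_zero, Matrix.cons_val_one, map_mul, map_pow]
  ring

lemma Th_coeff (k l : ℕ) (r : P2) (d : ℕ) :
    (Th k l r).coeff d = ∑ s ∈ r.support.filter (fun s => l * s 0 + k * s 1 = d),
      monomial s (coeff s r) := by
  conv_lhs => rw [r.as_sum, map_sum, Polynomial.finsetSum_coeff]
  rw [Finset.sum_filter]
  refine Finset.sum_congr rfl fun s _ => ?_
  rw [Th_monomial, Polynomial.coeff_monomial]

lemma weight_eq (k l : ℕ) (s : Fin 2 →₀ ℕ) :
    Finsupp.weight ![l, k] s = l * s 0 + k * s 1 := by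
  rw [Finsupp.weight_apply, Finsupp.sum_fintype _ _ (by simp), Fin.sum_univ_two]
  simp [mul_comm]

lemma Th_natDegree (k l : ℕ) (r : P2) : (Th k l r).natDegree = wdeg k l r := by
  by_cases hr : r = 0
  · subst hr; simp [wdeg, weightedTotalDegree]
  apply le_antisymm
  · rw [Polynomial.natDegree_le_iff_coeff_eq_zero]
    intro d hd
    rw [Th_coeff]
    apply Finset.sum_eq_zero
    intro s hs
    rw [Finset.mem_filter] at hs
    have := le_weightedTotalDegree ![l, k] hs.1
    rw [weight_eq] at this
    unfold wdeg at hd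
    omega
  · obtain ⟨s, hs, hs2⟩ := Finset.exists_mem_eq_sup r.support
      (by rwa [Finset.nonempty_iff_ne_empty, Ne, support_eq_empty])
      (fun s => Finsupp.weight ![l, k] s)
    apply Polynomial.le_natDegree_of_ne_zero
    intro h0
    rw [Th_coeff] at h0
    have h1 := congrArg (coeff s) h0
    rw [coeff_sum, Finset.sum_eq_single s] at h1
    · simp at h1
      exact (mem_support_iff.mp hs) h1
    · intro b _ hb
      rw [coeff_monomial, if_neg hb]
    · intro hn
      exfalso
      apply hn
      rw [Finset.mem_filter]
      refine ⟨hs, ?_⟩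
      rw [← weight_eq, wdeg, weightedTotalDegree]
      exact hs2.symm

lemma leadingPart_eq (k l : ℕ) (r : P2) : leadingPart k l r = (Th k l r).leadingCoeff := by
  rw [Polynomial.leadingCoeff, Th_coeff, Th_natDegree, leadingPart]

/-! primality -/

lemma reduce (k l : ℕ) (hl : 0 < l) (r : P2) :
    ∃ r' : P2, (X 0 ^ k + X 1 ^ l) ∣ r - r' ∧ ∀ s ∈ r'.support, s 1 < l := by
  induction r using MvPolynomial.induction_on' with
  | add p q hp hq =>
    obtain ⟨p', h1, h2⟩ := hp
    obtain ⟨q', h3, h4⟩ := hq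
    classical
    refine ⟨p' + q', by convert dvd_add h1 h3 using 1; ring, fun s hs => ?_⟩
    rcases Finset.mem_union.mp (support_add hs) with h | h
    · exact h2 s h
    · exact h4 s h
  | monomial u a =>
    suffices H : ∀ j i : ℕ, ∃ r' : P2, ((X 0 ^ k + X 1 ^ l) ∣ C a * X 0 ^ i * X 1 ^ j - r') ∧
        ∀ s ∈ r'.support, s 1 < l by
      have := H (u 1) (u 0)
      rwa [mul_assoc, ← Fin.prod_univ_two (fun i => (X i : P2) ^ u i),
        ← Finsupp.prod_fintype u (fun i e => (X i : P2) ^ e) (by simp), ← monomial_eq] at this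
    intro j
    induction j using Nat.strong_induction_on with
    | _ j ih =>
      intro i
      by_cases hj : j < l
      · refine ⟨C a * X 0 ^ i * X 1 ^ j, by simp, fun s hs => ?_⟩
        have : (C a * X 0 ^ i * X 1 ^ j : P2)
            = monomial (Finsupp.single 0 i + Finsupp.single 1 j) a := by
          rw [monomial_add_single, ← C_mul_X_pow_eq_monomial]
        rw [this] at hs
        have := support_monomial_subset hs
        rw [Finset.mem_singleton] at this
        subst this
        simpa using hj
      · obtain ⟨r', h1, h2⟩ := ih (j - l) (by omega) (i + k)
        refine ⟨-r', ?_, by simpa using h2⟩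
        have : (C a * X 0 ^ i * X 1 ^ j - -r' : P2) =
          (X 0 ^ k + X 1 ^ l) * (C a * X 0 ^ i * X 1 ^ (j - l))
            - (C a * X 0 ^ (i + k) * X 1 ^ (j - l) - r') := by
          obtain ⟨m, rfl⟩ := Nat.exists_eq_add_of_le (not_lt.mp hj)
          rw [Nat.add_sub_cancel_left]
          ring
        rw [this]
        exact dvd_sub (dvd_mul_right _ _) h1

noncomputable def ph (k l : ℕ) (γ : ℂ) : P2 →ₐ[ℂ] Polynomial ℂ :=
  aeval ![Polynomial.X ^ l, Polynomial.C γ * Polynomial.X ^ k]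

lemma ph_monomial (k l : ℕ) (γ : ℂ) (s : Fin 2 →₀ ℕ) (c : ℂ) :
    ph k l γ (monomial s c) = Polynomial.monomial (l * s 0 + k * s 1) (c * γ ^ s 1) := by
  rw [ph, aeval_monomial, Finsupp.prod_fintype _ _ (by simp), Fin.prod_univ_two]
  rw [← Polynomial.C_mul_X_pow_eq_monomial]
  have : algebraMap ℂ (Polynomial ℂ) c = Polynomial.C c := rfl
  rw [this]
  simp only [Matrix.cons_val_zero, Matrix.cons_val_one, map_mul, map_pow]
  ring

lemma ph_inj (k l : ℕ) (γ : ℂ) (hγ : γ ≠ 0) (hl : 0 < l) (hkl : Nat.Coprime k l) (r : P2)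
    (hr : ∀ s ∈ r.support, s 1 < l) (h0 : ph k l γ r = 0) : r = 0 := by
  ext s
  rw [coeff_zero]
  by_contra hs
  have hs' : s ∈ r.support := mem_support_iff.mpr hs
  have h1 := congrArg (fun p => Polynomial.coeff p (l * s 0 + k * s 1)) h0
  rw [r.as_sum, map_sum, Polynomial.finsetSum_coeff, Finset.sum_eq_single s] at h1
  · rw [ph_monomial, Polynomial.coeff_monomial, if_pos rfl] at h1
    simp [hs, hγ] at h1
  · intro b hb hbs
    rw [ph_monomial, Polynomial.coeff_monomial, if_neg]
    intro he
    apply hbs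
    have hb1 := hr b hb
    have hs1 := hr s hs'
    have e1 : b 1 = s 1 := by
      have : k * b 1 ≡ k * s 1 [MOD l] := by
        have h2 : (l * b 0 + k * b 1) ≡ (l * s 0 + k * s 1) [MOD l] := by rw [he]
        simpa [Nat.ModEq, Nat.mul_add_mod] using h2
      have := Nat.ModEq.cancel_left_of_coprime (by rwa [Nat.gcd_comm]) this
      rwa [Nat.ModEq, Nat.mod_eq_of_lt hb1, Nat.mod_eq_of_lt hs1] at this
    have e0 : b 0 = s 0 := by
      rw [e1] at he
      exact Nat.eq_of_mul_eq_mul_left hl (by omega)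
    ext i
    fin_cases i
    · exact e0
    · exact e1
  · intro h; exact absurd hs' h

lemma exists_root (l : ℕ) (hl : 0 < l) (z : ℂ) : ∃ γ : ℂ, γ ^ l = z :=
  IsAlgClosed.exists_pow_nat_eq z hl

lemma dvd_of_ph (k l : ℕ) (γ : ℂ) (hγ : γ ^ l = -1) (hl : 0 < l) (hkl : Nat.Coprime k l) (r : P2) :
    (X 0 ^ k + X 1 ^ l) ∣ r ↔ ph k l γ r = 0 := by
  have hu : ph k l γ (X 0 ^ k + X 1 ^ l) = 0 := by
    simp only [ph, map_add, map_pow, aeval_X, Matrix.cons_val_zero, Matrix.cons_val_one]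
    rw [mul_pow, ← map_pow, hγ, ← pow_mul, ← pow_mul, mul_comm k l]
    simp
  constructor
  · rintro ⟨q, rfl⟩
    rw [map_mul, hu, zero_mul]
  · intro h0
    obtain ⟨r', ⟨q, hq⟩, h2⟩ := reduce k l hl r
    have hγ0 : γ ≠ 0 := by
      rintro rfl
      rw [zero_pow hl.ne'] at hγ
      norm_num at hγ
    have : r' = 0 := by
      apply ph_inj k l γ hγ0 hl hkl r' h2
      have := congrArg (ph k l γ) hq
      rw [map_sub, map_mul, hu, h0, zero_mul, zero_sub, neg_eq_zero] at this
      exact this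
    rw [this, sub_zero] at hq
    exact ⟨q, hq⟩

lemma Th_u (k l : ℕ) : Th k l (X 0 ^ k + X 1 ^ l) =
    Polynomial.C (X 0 ^ k + X 1 ^ l) * Polynomial.X ^ (l * k) := by
  simp only [Th, map_add, map_pow, aeval_X, Matrix.cons_val_zero, Matrix.cons_val_one]
  rw [mul_pow, mul_pow, ← pow_mul, ← pow_mul, mul_comm k l]
  ring

lemma u_ne (k l : ℕ) : (X 0 ^ k + X 1 ^ l : P2) ≠ 0 := by
  intro h
  have := congrArg (MvPolynomial.eval ![1, 1]) h
  simp at this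

lemma u_prime (k l : ℕ) (hk : 0 < k) (hl : 0 < l) (hkl : Nat.Coprime k l) :
    Prime (X 0 ^ k + X 1 ^ l : P2) := by
  obtain ⟨γ, hγ⟩ := exists_root l hl (-1)
  refine ⟨u_ne k l, ?_, ?_⟩
  · intro h
    have := h.map (MvPolynomial.eval (![0, 0] : Fin 2 → ℂ))
    simp [hk.ne', hl.ne'] at this
  · intro a b
    simp only [dvd_of_ph k l γ hγ hl hkl, map_mul, mul_eq_zero]
    exact id

/-! integrality -/

noncomputable def rho (f : Polynomial ℂ) (a : ℕ) : P2 →ₐ[ℂ] Polynomial (Polynomial ℂ) :=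
  aeval ![Polynomial.C f * Polynomial.X ^ a, Polynomial.X]

lemma rho_coeff (f : Polynomial ℂ) (a : ℕ) (q : P2) (m : ℕ) :
    ∃ r : Polynomial ℂ, a * r.natDegree ≤ m ∧ (rho f a q).coeff m = Polynomial.aeval f r := by
  induction q using MvPolynomial.induction_on' with
  | add p q hp hq =>
    obtain ⟨r, h1, h2⟩ := hp
    obtain ⟨r', h3, h4⟩ := hq
    refine ⟨r + r', ?_, by rw [map_add, Polynomial.coeff_add, h2, h4, map_add]⟩
    have := Polynomial.natDegree_add_le r r'
    refine (Nat.mul_le_mul_left a this).trans ?_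
    rcases max_cases r.natDegree r'.natDegree with h | h <;> rw [h.1] <;> assumption
  | monomial s c =>
    have : rho f a (monomial s c)
        = Polynomial.monomial (a * s 0 + s 1) (Polynomial.C c * f ^ s 0) := by
      rw [rho, aeval_monomial, Finsupp.prod_fintype _ _ (by simp), Fin.prod_univ_two]
      rw [← Polynomial.C_mul_X_pow_eq_monomial]
      have : algebraMap ℂ (Polynomial (Polynomial ℂ)) c = Polynomial.C (Polynomial.C c) := rfl
      rw [this]
      simp only [Matrix.cons_val_zero, Matrix.cons_val_one, map_mul, map_pow]
      ring
    rw [this, Polynomial.coeff_monomial]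
    split_ifs with h
    · refine ⟨Polynomial.C c * Polynomial.X ^ s 0, ?_, by simp [Polynomial.algebraMap_eq]⟩
      have := Polynomial.natDegree_C_mul_X_pow_le c (s 0)
      have := Nat.mul_le_mul_left a this
      omega
    · exact ⟨0, by simp, by simp⟩

lemma integral_tS (f : Polynomial ℂ) (hf : f.Monic) (ha : 0 < f.natDegree) :
    (rho f f.natDegree).toRingHom.IsIntegralElem
      (Polynomial.X * Polynomial.C Polynomial.X) := by
  set ρ := rho f f.natDegree with hρ
  have hX0 : ρ (X 0) = Polynomial.C f * Polynomial.X ^ f.natDegree := by simp [hρ, rho]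
  have hX1 : ρ (X 1) = Polynomial.X := by simp [hρ, rho]
  set F := (f.map (algebraMap ℂ P2)) with hF
  have hFm : F.Monic := hf.map _
  have hFd : F.natDegree = f.natDegree := hf.natDegree_map _
  refine ⟨F.scaleRoots (X 1) - Polynomial.C (X 0), ?_, ?_⟩
  · apply Polynomial.Monic.sub_of_left
    · rwa [Polynomial.monic_scaleRoots_iff]
    · refine lt_of_le_of_lt Polynomial.degree_C_le ?_
      rw [Polynomial.degree_scaleRoots, ← Polynomial.natDegree_pos_iff_degree_pos, hFd]
      exact ha
  · rw [Polynomial.eval₂_sub, Polynomial.eval₂_C]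
    have h1 : (ρ.toRingHom (X 1)) = Polynomial.X := hX1
    have h0 : (ρ.toRingHom (X 0)) = Polynomial.C f * Polynomial.X ^ f.natDegree := hX0
    have := Polynomial.scaleRoots_eval₂_mul (p := F) ρ.toRingHom (Polynomial.C Polynomial.X) (X 1)
    rw [h1] at this
    rw [this, h0, hFd, hF, Polynomial.eval₂_map]
    have h2 : ρ.toRingHom.comp (algebraMap ℂ P2)
        = (Polynomial.C : Polynomial ℂ →+* _).comp Polynomial.C := by
      exact RingHom.ext fun c => ρ.commutes c
    rw [h2, ← Polynomial.hom_eval₂, Polynomial.eval₂_C_X]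
    ring

lemma integral_w (f : Polynomial ℂ) (hf : f.Monic) (ha : 0 < f.natDegree)
    (w : Polynomial ℂ) (e : ℕ) (he : w.natDegree ≤ e) :
    (rho f f.natDegree).toRingHom.IsIntegralElem
      (Polynomial.C w * Polynomial.X ^ e) := by
  have hX1 : (rho f f.natDegree).toRingHom.IsIntegralElem Polynomial.X := by
    have h1 : (rho f f.natDegree).toRingHom (X 1) = Polynomial.X :=
      show rho f f.natDegree (X 1) = Polynomial.X by simp [rho]
    rw [← h1]
    exact RingHom.isIntegralElem_map _
  have hC : ∀ c : ℂ, (rho f f.natDegree).toRingHom.IsIntegralElem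
      (Polynomial.C (Polynomial.C c)) := by
    intro c
    have h1 : (rho f f.natDegree).toRingHom (C c) = Polynomial.C (Polynomial.C c) :=
      (rho f f.natDegree).commutes c
    rw [← h1]
    exact RingHom.isIntegralElem_map _
  have hpow : ∀ x, (rho f f.natDegree).toRingHom.IsIntegralElem x → ∀ n : ℕ,
      (rho f f.natDegree).toRingHom.IsIntegralElem (x ^ n) := by
    intro x hx n
    induction n with
    | zero => rw [pow_zero]; exact RingHom.isIntegralElem_one _
    | succ n ih => rw [pow_succ]; exact RingHom.IsIntegralElem.mul _ ih hx
  have hw := w.as_sum_range' (e + 1) (by omega)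
  have : Polynomial.C w * Polynomial.X ^ e = ∑ i ∈ Finset.range (e + 1),
      Polynomial.C (Polynomial.C (w.coeff i)) *
        (Polynomial.X * Polynomial.C Polynomial.X) ^ i * Polynomial.X ^ (e - i) := by
    conv_lhs => rw [hw, map_sum, Finset.sum_mul]
    refine Finset.sum_congr rfl fun i hi => ?_
    have hi' : i ≤ e := by rw [Finset.mem_range] at hi; omega
    rw [← Polynomial.C_mul_X_pow_eq_monomial, map_mul, map_pow, mul_pow]
    obtain ⟨m, rfl⟩ := Nat.exists_eq_add_of_le hi'
    rw [Nat.add_sub_cancel_left]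
    ring
  rw [this]
  refine Finset.sum_induction _ (fun x => (rho f f.natDegree).toRingHom.IsIntegralElem x)
    (fun a b => RingHom.IsIntegralElem.add _) (RingHom.isIntegralElem_zero _) ?_
  intro i _
  exact RingHom.IsIntegralElem.mul _ (RingHom.IsIntegralElem.mul _ (hC _)
    (hpow _ (integral_tS f hf ha) i)) (hpow _ hX1 _)

lemma relation (f : Polynomial ℂ) (hf : f.Monic) (ha : 0 < f.natDegree)
    (w : Polynomial ℂ) (e : ℕ) (he : w.natDegree ≤ e) :
    ∃ (N : ℕ) (r : ℕ → Polynomial ℂ),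
      (∀ i < N, f.natDegree * (r i).natDegree ≤ e * (N - i)) ∧
      w ^ N + ∑ i ∈ Finset.range N, Polynomial.aeval f (r i) * w ^ i = 0 := by
  obtain ⟨P, hP, h0⟩ := integral_w f hf ha w e he
  choose r hr1 hr2 using fun i : ℕ => rho_coeff f f.natDegree (P.coeff i) (e * (P.natDegree - i))
  refine ⟨P.natDegree, r, fun i _ => hr1 i, ?_⟩
  rw [Polynomial.eval₂_eq_sum_range, Finset.sum_range_succ] at h0
  have h1 := congrArg (fun p => Polynomial.coeff p (e * P.natDegree)) h0
  simp only [Polynomial.coeff_add, Polynomial.finsetSum_coeff, Polynomial.coeff_zero] at h1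
  rw [add_comm, ← h1]
  congr 1
  · refine Finset.sum_congr rfl fun i hi => ?_
    rw [Finset.mem_range] at hi
    rw [← hr2, mul_pow, ← pow_mul, ← map_pow, ← mul_assoc, Polynomial.coeff_mul_X_pow']
    have : e * i ≤ e * P.natDegree := Nat.mul_le_mul_left _ hi.le
    rw [if_pos this, Polynomial.coeff_mul_C, Nat.mul_sub]
    rfl
  · rw [Polynomial.coeff_natDegree, hP, map_one, one_mul, mul_pow, ← pow_mul, ← map_pow,
      Polynomial.coeff_C_mul_X_pow, if_pos rfl]

lemma main_case (φ : P2 →ₐ[ℂ] Polynomial ℂ) (p : P2) (hp : ∀ r, φ r = 0 ↔ p ∣ r)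
    (k l n : ℕ) (hk : 0 < k) (hl : 0 < l) (hn : 0 < n) (hkl : Nat.Coprime k l)
    (hfm : (φ (X 0)).Monic) (hf : (φ (X 0)).natDegree = l * n)
    (hg : (φ (X 1)).natDegree = k * n) (hgl : (φ (X 1)).leadingCoeff ^ l = -1) :
    ∃ (c : ℂ) (m : ℕ), c ≠ 0 ∧ 0 < m ∧ leadingPart k l p = C c * (X 0 ^ k + X 1 ^ l) ^ m := by
  set f := φ (X 0) with hfdef
  set g := φ (X 1) with hgdef
  set u : P2 := X 0 ^ k + X 1 ^ l with hu
  set D := l * k * n with hD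
  have hDpos : 0 < D := by positivity
  have hw : (φ u).natDegree ≤ D - 1 := by
    have hphi : φ u = f ^ k + g ^ l := by simp [hu, hfdef, hgdef]
    rw [hphi, Polynomial.natDegree_le_iff_coeff_eq_zero]
    intro d hd
    have h1 : (f ^ k).natDegree = D := by rw [Polynomial.natDegree_pow, hf, hD]; ring
    have h2 : (g ^ l).natDegree = D := by rw [Polynomial.natDegree_pow, hg, hD]; ring
    rcases (show D ≤ d by omega).eq_or_lt with h | h
    · rw [← h, Polynomial.coeff_add]
      nth_rewrite 1 [← h1]
      rw [← h2, Polynomial.coeff_natDegree, Polynomial.coeff_natDegree,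
        Polynomial.leadingCoeff_pow, Polynomial.leadingCoeff_pow, hgl, hfm]
      simp
    · rw [Polynomial.coeff_add, Polynomial.coeff_eq_zero_of_natDegree_lt (by omega),
        Polynomial.coeff_eq_zero_of_natDegree_lt (by omega), add_zero]
  obtain ⟨N, r, hr1, hr2⟩ := relation f hfm (by rw [hf]; positivity) (φ u) _ hw
  set h : P2 := u ^ N + ∑ i ∈ Finset.range N, Polynomial.aeval (X 0) (r i) * u ^ i with hh
  have hφh : φ h = 0 := by
    rw [← hr2, hh]
    simp only [map_add, map_sum, map_mul, map_pow, ← Polynomial.aeval_algHom_apply, ← hfdef]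
  have hTu : Th k l u = Polynomial.C u * Polynomial.X ^ (l * k) := Th_u k l
  have hune : u ≠ 0 := u_ne k l
  have hTuN : ∀ i, Th k l (u ^ i) = Polynomial.C (u ^ i) * Polynomial.X ^ (l * k * i) := by
    intro i
    rw [map_pow, hTu, mul_pow, ← pow_mul, map_pow]
  have hlead : (Th k l h).leadingCoeff = u ^ N := by
    rw [hh, map_add, Polynomial.leadingCoeff_add_of_degree_lt', hTuN,
      Polynomial.leadingCoeff_mul_X_pow, Polynomial.leadingCoeff_C]
    rw [hTuN, Polynomial.degree_C_mul_X_pow _ (pow_ne_zero _ hune), map_sum]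
    refine (Polynomial.degree_sum_le _ _).trans_lt ?_
    rw [Finset.sup_lt_iff (WithBot.bot_lt_coe _)]
    intro i hi
    rw [Finset.mem_range] at hi
    rw [map_mul, hTuN, ← Polynomial.aeval_algHom_apply]
    have hb : (Polynomial.aeval (Th k l (X 0)) (r i)).natDegree ≤ l * (r i).natDegree := by
      rw [Polynomial.aeval_eq_sum_range]
      apply Polynomial.natDegree_sum_le_of_forall_le
      intro j hj
      rw [Finset.mem_range] at hj
      refine (Polynomial.natDegree_smul_le _ _).trans ?_
      have : Th k l (X 0) = Polynomial.C (X 0) * Polynomial.X ^ l := by simp [Th]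
      rw [this, mul_pow, ← map_pow, ← pow_mul]
      refine (Polynomial.natDegree_C_mul_X_pow_le _ _).trans ?_
      exact Nat.mul_le_mul_left _ (by omega)
    refine lt_of_le_of_lt Polynomial.degree_le_natDegree ?_
    rw [Nat.cast_lt]
    refine lt_of_le_of_lt Polynomial.natDegree_mul_le ?_
    refine lt_of_le_of_lt (Nat.add_le_add hb (Polynomial.natDegree_C_mul_X_pow_le _ _)) ?_
    have h3 := hr1 i hi
    rw [hf] at h3
    obtain ⟨m, rfl⟩ := Nat.exists_eq_add_of_lt hi
    have h4 : i + m + 1 - i = m + 1 := by omega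
    rw [h4] at h3
    have h5 : (D - 1) * (m + 1) < D * (m + 1) :=
      Nat.mul_lt_mul_of_pos_right (by omega) (by omega)
    have h6 : n * (l * (r i).natDegree) < n * (l * k * (m + 1)) := by
      calc n * (l * (r i).natDegree) = l * n * (r i).natDegree := by ring
        _ < D * (m + 1) := lt_of_le_of_lt h3 h5
        _ = _ := by rw [hD]; ring
    have h7 := Nat.lt_of_mul_lt_mul_left h6
    calc _ < l * k * (m + 1) + l * k * i := by omega
      _ = _ := by ring
  obtain ⟨q, hq⟩ := (hp h).mp hφh
  have hdvd : leadingPart k l p ∣ u ^ N := by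
    rw [← hlead, hq, map_mul, Polynomial.leadingCoeff_mul, leadingPart_eq]
    exact dvd_mul_right _ _
  obtain ⟨m, -, hm⟩ := (dvd_prime_pow (u_prime k l hk hl hkl) N).mp hdvd
  obtain ⟨v, hv⟩ := hm.symm
  have hvu := v.isUnit
  rw [MvPolynomial.isUnit_iff_eq_C_of_isReduced] at hvu
  obtain ⟨c, hc, hvc⟩ := hvu
  have hform : leadingPart k l p = C c * u ^ m := by rw [← hv, hvc, mul_comm]
  refine ⟨c, m, hc.ne_zero, ?_, hform⟩
  rcases Nat.eq_zero_or_pos m with h0 | h0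
  swap
  · exact h0
  exfalso
  subst h0
  rw [pow_zero, mul_one] at hform
  -- `p` is then a nonzero constant
  have hwd : wdeg k l p = 0 := by
    by_contra hne
    have e1 : (Th k l p).coeff (wdeg k l p) = C c := by
      rw [← hform, leadingPart_eq, ← Th_natDegree]; rfl
    rw [Th_coeff] at e1
    have e2 := congrArg (coeff 0) e1
    rw [coeff_sum, coeff_zero_C, Finset.sum_eq_zero] at e2
    · exact hc.ne_zero e2.symm
    · intro s hs
      rw [Finset.mem_filter] at hs
      rw [coeff_monomial, if_neg]
      rintro rfl
      simp at hs
      exact hne hs.2.symm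
  have hpC : p = C c := by
    rw [← hform, leadingPart, hwd]
    conv_lhs => rw [p.as_sum]
    rw [Finset.filter_true_of_mem]
    intro s hs
    have := le_weightedTotalDegree ![l, k] hs
    rw [weight_eq] at this
    unfold wdeg at hwd
    omega
  have : φ 1 = 0 := by
    rw [hp, hpC]
    exact (hc.map C).dvd
  rw [map_one] at this
  exact one_ne_zero this

/-! automorphisms -/

noncomputable def scaleA (a b : ℂ) (ha : a ≠ 0) (hb : b ≠ 0) : P2 ≃ₐ[ℂ] P2 :=
  AlgEquiv.ofAlgHom (aeval ![C a * X 0, C b * X 1]) (aeval ![C a⁻¹ * X 0, C b⁻¹ * X 1])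
    (by
      ext i : 1
      fin_cases i <;> simp [← mul_assoc, ← C_mul, ha, hb, algebraMap_eq])
    (by
      ext i : 1
      fin_cases i <;> simp [← mul_assoc, ← C_mul, ha, hb, algebraMap_eq])

noncomputable def shearA (c : ℂ) (m : ℕ) : P2 ≃ₐ[ℂ] P2 :=
  AlgEquiv.ofAlgHom (aeval ![X 0, X 1 + C c * X 0 ^ m]) (aeval ![X 0, X 1 - C c * X 0 ^ m])
    (by
      ext i : 1
      fin_cases i <;> simp [algebraMap_eq])
    (by
      ext i : 1
      fin_cases i <;> simp [algebraMap_eq])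

noncomputable def swapA : P2 ≃ₐ[ℂ] P2 := renameEquiv ℂ (Equiv.swap 0 1)

def Conc (p : P2) : Prop :=
    ∃ α : MvPolynomial (Fin 2) ℂ ≃ₐ[ℂ] MvPolynomial (Fin 2) ℂ,
      (α p).totalDegree = 1 ∨
      ∃ k l n : ℕ, 2 ≤ k ∧ 2 ≤ l ∧ Nat.Coprime k l ∧ 0 < n ∧
        leadingPart k l (α p) = (X 0 ^ k + X 1 ^ l) ^ n

lemma Conc.of_equiv (p : P2) (σ : P2 ≃ₐ[ℂ] P2) (h : Conc (σ p)) : Conc p := by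
  obtain ⟨α, h⟩ := h
  exact ⟨σ.trans α, h⟩

lemma transfer (φ : P2 →ₐ[ℂ] Polynomial ℂ) (p : P2) (hp : ∀ r, φ r = 0 ↔ p ∣ r)
    (σ : P2 ≃ₐ[ℂ] P2) : ∀ r, (φ.comp σ.symm.toAlgHom) r = 0 ↔ σ p ∣ r := by
  intro r
  have : (φ.comp σ.symm.toAlgHom) r = φ (σ.symm r) := rfl
  rw [this, hp]
  constructor
  · intro h
    have := map_dvd σ h
    rwa [AlgEquiv.apply_symm_apply] at this
  · intro h
    have := map_dvd σ.symm h
    rwa [AlgEquiv.symm_apply_apply] at this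

lemma leadingPart_scale (k l : ℕ) (a b : ℂ) (ha : a ≠ 0) (hb : b ≠ 0) (p : P2) :
    leadingPart k l (scaleA a b ha hb p) = scaleA a b ha hb (leadingPart k l p) := by
  set σ := scaleA a b ha hb with hσ
  have h : (Th k l).comp σ.toAlgHom = (Polynomial.mapAlgHom σ.toAlgHom).comp (Th k l) := by
    ext i : 1
    fin_cases i <;>
    simp [hσ, scaleA, Th, algebraMap_eq, Polynomial.algebraMap_apply, mul_assoc]
  have h1 := DFunLike.congr_fun h p
  have h2 : Th k l (σ p) = (Th k l p).map σ.toAlgHom.toRingHom := h1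
  rw [leadingPart_eq, leadingPart_eq, h2,
    Polynomial.leadingCoeff_map_of_injective (show Function.Injective σ.toAlgHom.toRingHom from σ.injective)]
  rfl

lemma const_case (φ : P2 →ₐ[ℂ] Polynomial ℂ) (p : P2) (hp : ∀ r, φ r = 0 ↔ p ∣ r) (i : Fin 2)
    (h0 : (φ (X i)).natDegree = 0) : Conc p := by
  refine ⟨AlgEquiv.refl, Or.inl ?_⟩
  rw [AlgEquiv.coe_refl, id]
  obtain ⟨c, hc⟩ := Polynomial.natDegree_eq_zero.mp h0
  have h1 : φ (X i - C c) = 0 := by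
    rw [map_sub, ← hc, ← algebraMap_eq, AlgHom.commutes]
    exact sub_self _
  obtain ⟨r, hr⟩ := (hp _).mp h1
  have hd : (X i - C c : P2).totalDegree = 1 := by
    apply le_antisymm
    · refine (totalDegree_sub _ _).trans ?_
      simp
    · rw [Nat.one_le_iff_ne_zero]
      intro hz
      rw [totalDegree_eq_zero_iff_eq_C] at hz
      have := congrArg (coeff (Finsupp.single i 1)) hz
      simp [coeff_C] at this
  have hne : (X i - C c : P2) ≠ 0 := by
    intro h; rw [h] at hd; simp at hd
  have hp0 : p ≠ 0 := by rintro rfl; simp at hr; exact hne hr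
  have hr0 : r ≠ 0 := by rintro rfl; simp at hr; exact hne hr
  rw [hr, totalDegree_mul_of_isDomain hp0 hr0] at hd
  by_contra hne1
  have hz : p.totalDegree = 0 := by omega
  rw [totalDegree_eq_zero_iff_eq_C] at hz
  have hcne : coeff 0 p ≠ 0 := by
    intro h; rw [h, C_0] at hz; exact hp0 hz
  have : φ 1 = 0 := by
    rw [hp, hz]
    exact ((isUnit_iff_ne_zero.mpr hcne).map C).dvd
  rw [map_one] at this
  exact one_ne_zero this

lemma final_case (φ : P2 →ₐ[ℂ] Polynomial ℂ) (p : P2) (hp : ∀ r, φ r = 0 ↔ p ∣ r)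
    (ha : ¬ (φ (X 0)).natDegree ∣ (φ (X 1)).natDegree)
    (hb : ¬ (φ (X 1)).natDegree ∣ (φ (X 0)).natDegree) : Conc p := by
  set f := φ (X 0) with hf
  set g := φ (X 1) with hg
  have hb0 : g.natDegree ≠ 0 := fun h => ha (by rw [h]; exact dvd_zero _)
  have ha0 : f.natDegree ≠ 0 := fun h => hb (by rw [h]; exact dvd_zero _)
  obtain ⟨n, l, k, hn, hlk, hln, hkn⟩ := Nat.exists_coprime' (m := f.natDegree) (n := g.natDegree)
    (Nat.gcd_pos_of_pos_left _ (Nat.pos_of_ne_zero ha0))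
  have hl : 2 ≤ l := by
    rcases l with _ | _ | l
    · simp at hln; exact absurd hln (by simpa using ha0)
    · exfalso; apply ha; rw [hln, hkn]; simp
    · omega
  have hk : 2 ≤ k := by
    rcases k with _ | _ | k
    · simp at hkn; exact absurd hkn (by simpa using hb0)
    · exfalso; apply hb; rw [hln, hkn]; simp
    · omega
  have hf0 : f ≠ 0 := by intro h; rw [h] at ha0; simp at ha0
  have hg0 : g ≠ 0 := by intro h; rw [h] at hb0; simp at hb0
  have hfl := Polynomial.leadingCoeff_ne_zero.mpr hf0
  have hgl := Polynomial.leadingCoeff_ne_zero.mpr hg0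
  obtain ⟨γ, hγ⟩ := exists_root l (by omega) (-1)
  have hγ0 : γ ≠ 0 := by
    rintro rfl
    rw [zero_pow (by omega)] at hγ
    norm_num at hγ
  -- normalise the leading coefficients
  set σ := scaleA f.leadingCoeff (g.leadingCoeff * γ⁻¹) hfl
    (mul_ne_zero hgl (inv_ne_zero hγ0)) with hσ
  apply Conc.of_equiv p σ
  have hT := transfer φ p hp σ
  have e0 : (φ.comp σ.symm.toAlgHom) (X 0) = Polynomial.C f.leadingCoeff⁻¹ * f := by
    have : σ.symm (X 0) = C f.leadingCoeff⁻¹ * X 0 := by simp [hσ, scaleA]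
    change φ (σ.symm (X 0)) = _
    rw [this, map_mul, ← algebraMap_eq, AlgHom.commutes]
    rfl
  have e1 : (φ.comp σ.symm.toAlgHom) (X 1) = Polynomial.C (g.leadingCoeff * γ⁻¹)⁻¹ * g := by
    have : σ.symm (X 1) = C (g.leadingCoeff * γ⁻¹)⁻¹ * X 1 := by simp [hσ, scaleA]
    change φ (σ.symm (X 1)) = _
    rw [this, map_mul, ← algebraMap_eq, AlgHom.commutes]
    rfl
  obtain ⟨c, m, hc, hm, hlead⟩ := main_case (φ.comp σ.symm.toAlgHom) (σ p) hT k l n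
    (by omega) (by omega) hn hlk.symm
    (by
      rw [e0, Polynomial.Monic, Polynomial.leadingCoeff_mul, Polynomial.leadingCoeff_C]
      exact inv_mul_cancel₀ hfl)
    (by rw [e0, Polynomial.natDegree_C_mul (inv_ne_zero hfl), hln])
    (by rw [e1, Polynomial.natDegree_C_mul (inv_ne_zero (mul_ne_zero hgl (inv_ne_zero hγ0))), hkn])
    (by
      rw [e1, Polynomial.leadingCoeff_mul, Polynomial.leadingCoeff_C, ← hγ]
      congr 1
      field_simp)
  obtain ⟨ρ, hρ⟩ := exists_root m hm c⁻¹
  have hρ0 : ρ ≠ 0 := by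
    rintro rfl
    rw [zero_pow hm.ne'] at hρ
    exact inv_ne_zero hc hρ.symm
  obtain ⟨a, haρ⟩ := exists_root k (by omega) ρ
  obtain ⟨b, hbρ⟩ := exists_root l (by omega) ρ
  have ha1 : a ≠ 0 := by rintro rfl; rw [zero_pow (by omega)] at haρ; exact hρ0 haρ.symm
  have hb1 : b ≠ 0 := by rintro rfl; rw [zero_pow (by omega)] at hbρ; exact hρ0 hbρ.symm
  refine ⟨scaleA a b ha1 hb1, Or.inr ⟨k, l, m, hk, hl, hlk.symm, hm, ?_⟩⟩
  rw [leadingPart_scale, hlead]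
  have s0 : scaleA a b ha1 hb1 (X 0) = C a * X 0 := by simp [scaleA]
  have s1 : scaleA a b ha1 hb1 (X 1) = C b * X 1 := by simp [scaleA]
  have sc : scaleA a b ha1 hb1 (C c) = C c := (scaleA a b ha1 hb1).commutes c
  rw [map_mul, map_pow, map_add, map_pow, map_pow, s0, s1, sc, mul_pow, mul_pow, ← C_pow, ← C_pow,
    haρ, hbρ, ← mul_add, mul_pow, ← C_pow, hρ, ← mul_assoc, ← C_mul, mul_inv_cancel₀ hc, C_1,
    one_mul]

lemma deg_drop (f g : Polynomial ℂ) (m : ℕ) (hf : f ≠ 0) (hm : g.natDegree = f.natDegree * m)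
    (hg : 0 < g.natDegree) :
    ∃ c : ℂ, (g - Polynomial.C c * f ^ m).natDegree < g.natDegree := by
  have hfl := pow_ne_zero m (Polynomial.leadingCoeff_ne_zero.mpr hf)
  refine ⟨g.leadingCoeff / f.leadingCoeff ^ m, ?_⟩
  have h2 : (f ^ m).natDegree = g.natDegree := by rw [Polynomial.natDegree_pow, hm, mul_comm]
  have : (g - Polynomial.C (g.leadingCoeff / f.leadingCoeff ^ m) * f ^ m).natDegree
      ≤ g.natDegree - 1 := by
    rw [Polynomial.natDegree_le_iff_coeff_eq_zero]
    intro d hd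
    rw [Polynomial.coeff_sub, Polynomial.coeff_C_mul]
    rcases (show g.natDegree ≤ d by omega).eq_or_lt with h | h
    · rw [← h]
      nth_rewrite 2 [← h2]
      rw [Polynomial.coeff_natDegree, Polynomial.coeff_natDegree, Polynomial.leadingCoeff_pow]
      field_simp
      simp
    · rw [Polynomial.coeff_eq_zero_of_natDegree_lt (by omega),
        Polynomial.coeff_eq_zero_of_natDegree_lt (by omega)]
      simp
  omega

lemma main (d : ℕ) : ∀ (φ : P2 →ₐ[ℂ] Polynomial ℂ) (p : P2), (∀ r, φ r = 0 ↔ p ∣ r) →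
    (φ (X 0)).natDegree + (φ (X 1)).natDegree = d → Conc p := by
  induction d using Nat.strong_induction_on with
  | _ d ih =>
    have step : ∀ (φ : P2 →ₐ[ℂ] Polynomial ℂ) (p : P2), (∀ r, φ r = 0 ↔ p ∣ r) →
        (φ (X 0)).natDegree + (φ (X 1)).natDegree = d →
        (φ (X 0)).natDegree ∣ (φ (X 1)).natDegree → 0 < (φ (X 0)).natDegree →
        0 < (φ (X 1)).natDegree → Conc p := by
      intro φ p hp hd hdvd h0 h1
      obtain ⟨m, hm⟩ := hdvd
      obtain ⟨c, hc⟩ := deg_drop (φ (X 0)) (φ (X 1)) m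
        (by intro h; rw [h] at h0; simp at h0) hm h1
      apply Conc.of_equiv p (shearA c m)
      refine ih _ ?_ _ _ (transfer φ p hp (shearA c m)) rfl
      have e0 : (φ.comp (shearA c m).symm.toAlgHom) (X 0) = φ (X 0) := by
        change φ ((shearA c m).symm (X 0)) = _
        simp [shearA]
      have e1 : (φ.comp (shearA c m).symm.toAlgHom) (X 1)
          = φ (X 1) - Polynomial.C c * φ (X 0) ^ m := by
        have : (shearA c m).symm (X 1) = X 1 - C c * X 0 ^ m := by simp [shearA]
        change φ ((shearA c m).symm (X 1)) = _
        rw [this, map_sub, map_mul, map_pow, ← algebraMap_eq, AlgHom.commutes]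
        rfl
      rw [e0, e1]
      omega
    intro φ p hp hd
    by_cases h0 : (φ (X 0)).natDegree = 0
    · exact const_case φ p hp 0 h0
    by_cases h1 : (φ (X 1)).natDegree = 0
    · exact const_case φ p hp 1 h1
    by_cases ha : (φ (X 0)).natDegree ∣ (φ (X 1)).natDegree
    · exact step φ p hp hd ha (by omega) (by omega)
    by_cases hb : (φ (X 1)).natDegree ∣ (φ (X 0)).natDegree
    · apply Conc.of_equiv p swapA
      have e0 : (φ.comp swapA.symm.toAlgHom) (X 0) = φ (X 1) := by
        change φ (swapA.symm (X 0)) = _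
        simp [swapA]
      have e1 : (φ.comp swapA.symm.toAlgHom) (X 1) = φ (X 0) := by
        change φ (swapA.symm (X 1)) = _
        simp [swapA]
      apply step _ _ (transfer φ p hp swapA)
      · rw [e0, e1]; omega
      · rw [e0, e1]; exact hb
      · rw [e0]; omega
      · rw [e1]; omega
    · exact final_case φ p hp ha hb

end RL

/-- Lemma 1 of the paper: if `ℂ[x,y]/(p) ≅ ℂ[t]`, then after a polynomial change of
coordinates `α`, the polynomial `q = α(p)` is either linear, or its leading
quasi-homogeneous part with respect to some weights `(k, l)` with `k, l ≥ 2` coprime is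
`(x^k + y^l)^n` for some `n ≥ 1`. -/
theorem reduction_lemma
    (p : MvPolynomial (Fin 2) ℂ)
    (h : Nonempty ((MvPolynomial (Fin 2) ℂ ⧸ Ideal.span {p}) ≃ₐ[ℂ] Polynomial ℂ)) :
    ∃ α : MvPolynomial (Fin 2) ℂ ≃ₐ[ℂ] MvPolynomial (Fin 2) ℂ,
      (α p).totalDegree = 1 ∨
      ∃ k l n : ℕ, 2 ≤ k ∧ 2 ≤ l ∧ Nat.Coprime k l ∧ 0 < n ∧
        leadingPart k l (α p) = (X 0 ^ k + X 1 ^ l) ^ n := by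
  obtain ⟨e⟩ := h
  refine RL.main _ (e.toAlgHom.comp (Ideal.Quotient.mkₐ ℂ (Ideal.span {p}))) p ?_ rfl
  intro r
  have : (e.toAlgHom.comp (Ideal.Quotient.mkₐ ℂ (Ideal.span {p}))) r
    = e (Ideal.Quotient.mk (Ideal.span {p}) r) := rfl
  rw [this, EmbeddingLike.map_eq_zero_iff, Ideal.Quotient.eq_zero_iff_mem,
    Ideal.mem_span_singleton]
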